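/- Let R be a commutative ring and, for each q = 1, ..., n, let c^q_{12}, c^q_{23}, c^q_{31} ∈ R with c^q_{12} + c^q_{23} + c^q_{31} = 0; set c^q_{ji} = -c^q_{ij}. Suppose ζ = ζ_1 ⋯ ζ_n where each ζ_q = (c^q_{12})^{a_q} (c^q_{23})^{b_q} (c^q_{31})^{e_q}, and suppose for each q there exists r_q ≥ 0 with a_q + b_q + e_q ≥ 3 r_q - 1. Then ζ lies in the ideal generated by all products ∏_{q=1}^n (c^q_{σ_q(1)σ_q(2)} c^q_{σ_q(1)σ_q(3)})^{r_q} over all choices of permutations σ_q of (1,2,3). -/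

import Mathlib

theorem pow_mul_pow_mul_pow_mem_of_add_eq_zero {R : Type*} [CommRing R] {I : Ideal R}
    {x y z : R} (hsum : x + y + z = 0) {a b e r : ℕ} (hra : r ≤ a)
    (hre : 3 * r ≤ a + b + e + 1) (hxy : (x * y) ^ r ∈ I) (hxz : (x * z) ^ r ∈ I) :
    x ^ a * y ^ b * z ^ e ∈ I := by
  obtain ⟨m, rfl⟩ := Nat.exists_eq_add_of_le hra
  have hx : x = -1 * (y + z) := by linear_combination hsum
  have hexp : x ^ (r + m) * y ^ b * z ^ e =
      (-1) ^ m * ∑ p ∈ Finset.HasAntidiagonal.antidiagonal m,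
        x ^ r * y ^ b * z ^ e * (m.choose p.1 • (y ^ p.1 * z ^ p.2)) := by
    have hxm : x ^ m = (-1) ^ m * (y + z) ^ m := by rw [← mul_pow, ← hx]
    rw [← Finset.mul_sum, ← (Commute.all y z).add_pow', pow_add, hxm]
    ring
  rw [hexp]
  refine I.mul_mem_left _ (I.sum_mem fun p hp => ?_)
  rw [Finset.HasAntidiagonal.mem_antidiagonal] at hp
  rw [nsmul_eq_mul]
  by_cases h : r ≤ b + p.1
  · obtain ⟨t, ht⟩ := Nat.exists_eq_add_of_le h
    have : x ^ r * y ^ b * z ^ e * (m.choose p.1 * (y ^ p.1 * z ^ p.2)) =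
        (m.choose p.1 * y ^ t * z ^ (e + p.2)) * (x * y) ^ r := by
      have hy : y ^ b * y ^ p.1 = y ^ r * y ^ t := by rw [← pow_add, ht, pow_add]
      rw [mul_pow, pow_add]
      linear_combination x ^ r * z ^ e * m.choose p.1 * z ^ p.2 * hy
    rw [this]
    exact I.mul_mem_left _ hxy
  · obtain ⟨t, ht⟩ := Nat.exists_eq_add_of_le (show r ≤ e + p.2 by omega)
    have : x ^ r * y ^ b * z ^ e * (m.choose p.1 * (y ^ p.1 * z ^ p.2)) =
        (m.choose p.1 * z ^ t * y ^ (b + p.1)) * (x * z) ^ r := by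
      have hz : z ^ e * z ^ p.2 = z ^ r * z ^ t := by rw [← pow_add, ht, pow_add]
      rw [mul_pow, pow_add]
      linear_combination x ^ r * y ^ b * m.choose p.1 * y ^ p.1 * hz
    rw [this]
    exact I.mul_mem_left _ hxz

theorem pow_mul_pow_mul_pow_mem_span_perm {R : Type*} [CommRing R] (c : Fin 3 → Fin 3 → R)
    (hanti : ∀ i j, c i j = -c j i) (hcocycle : ∀ i j k, c i j + c j k = c i k)
    {a b e r : ℕ} (hre : 3 * r ≤ a + b + e + 1) :
    c 0 1 ^ a * c 1 2 ^ b * c 2 0 ^ e ∈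
      Ideal.span {x : R | ∃ σ : Equiv.Perm (Fin 3),
        x = (c (σ 0) (σ 1) * c (σ 0) (σ 2)) ^ r} := by
  set I := Ideal.span {x : R | ∃ σ : Equiv.Perm (Fin 3),
    x = (c (σ 0) (σ 1) * c (σ 0) (σ 2)) ^ r}
  have hgen (σ : Equiv.Perm (Fin 3)) : (c (σ 1) (σ 0) * c (σ 0) (σ 2)) ^ r ∈ I := by
    rw [hanti (σ 1), neg_mul, neg_pow]
    exact I.mul_mem_left _ (Ideal.subset_span ⟨σ, rfl⟩)
  have hxy : (c 0 1 * c 1 2) ^ r ∈ I := hgen (Equiv.swap 0 1)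
  have hyz : (c 1 2 * c 2 0) ^ r ∈ I := hgen (Equiv.swap 0 2)
  have hzx : (c 2 0 * c 0 1) ^ r ∈ I := hgen (Equiv.swap 1 2)
  have hsum : c 0 1 + c 1 2 + c 2 0 = 0 := by
    rw [hcocycle, hanti 2 0, add_neg_cancel]
  obtain h | h | h : r ≤ a ∨ r ≤ b ∨ r ≤ e := by omega
  · exact pow_mul_pow_mul_pow_mem_of_add_eq_zero hsum h hre hxy (mul_comm (c 2 0) _ ▸ hzx)
  · rw [mul_assoc, mul_comm]
    exact pow_mul_pow_mul_pow_mem_of_add_eq_zero (by linear_combination hsum) h (by omega) hyz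
      (mul_comm (c 0 1) _ ▸ hxy)
  · rw [mul_comm, ← mul_assoc]
    exact pow_mul_pow_mul_pow_mem_of_add_eq_zero (by linear_combination hsum) h (by omega) hzx
      (mul_comm (c 1 2) _ ▸ hyz)

/-- Algebraic core of Theorem 3.2: a product `ζ = ∏_q (c^q_{12})^{a_q}(c^q_{23})^{b_q}(c^q_{31})^{e_q}`
with `a_q + b_q + e_q ≥ 3 r_q - 1` for each `q` lies in the ideal generated by the monomials
`∏_q (c^q_{σ_q(1)σ_q(2)} c^q_{σ_q(1)σ_q(3)})^{r_q}` over all choices of permutations `σ_q`. -/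
theorem stmt_13 (R : Type*) [CommRing R] (n : ℕ)
    (cc : Fin n → Fin 3 → Fin 3 → R)
    (hanti : ∀ q i j, cc q i j = -cc q j i)
    (hcocycle : ∀ q i j k, cc q i j + cc q j k = cc q i k)
    (a b e r : Fin n → ℕ)
    (hre : ∀ q, 3 * r q ≤ a q + b q + e q + 1) :
    (∏ q, (cc q 0 1) ^ a q * (cc q 1 2) ^ b q * (cc q 2 0) ^ e q) ∈
      Ideal.span {x : R | ∃ σ : Fin n → Equiv.Perm (Fin 3),
        x = ∏ q, (cc q (σ q 0) (σ q 1) * cc q (σ q 0) (σ q 2)) ^ r q} := by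
  have hprod := Ideal.prod_mem_prod (s := Finset.univ) fun q _ =>
    pow_mul_pow_mul_pow_mem_span_perm (cc q) (hanti q) (hcocycle q) (hre q)
  rw [Ideal.prod_span] at hprod
  refine Ideal.span_mono (fun x hx => ?_) hprod
  obtain ⟨g, hg, rfl⟩ := (Set.mem_fintype_prod _ _).mp hx
  choose σ hσ using hg
  exact ⟨σ, Finset.prod_congr rfl fun q _ => hσ q⟩
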